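/- Let μ ∈ ℝ and define K(x,t) = sin(μ √(x² − t²)). Then for all x, t with 0 < t < x, K satisfies the hyperbolic equation ∂ₜₜK(x,t) = ∂ₓₓK(x,t) − (1/x) ∂ₓK(x,t) + μ² K(x,t). -/

import Mathlib

/-- A square root of a quadratic `√(a u² + b)` is differentiable where the quadratic is positive. -/
theorem hasDerivAt_sqrt_quadratic {a b u : ℝ} (h : 0 < a * u ^ 2 + b) :
    HasDerivAt (fun u : ℝ => √(a * u ^ 2 + b)) (a * u / √(a * u ^ 2 + b)) u := by
  have h₁ : HasDerivAt (fun u : ℝ => a * u ^ 2 + b) (a * (2 * u)) u := by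
    simpa using (((hasDerivAt_id u).pow 2).const_mul a).add_const b
  refine (h₁.sqrt h.ne').congr_deriv ?_
  have : √(a * u ^ 2 + b) ≠ 0 := (Real.sqrt_pos.2 h).ne'
  field_simp

theorem hasDerivAt_sin_sqrt_quadratic (μ : ℝ) {a b u : ℝ} (h : 0 < a * u ^ 2 + b) :
    HasDerivAt (fun u : ℝ => Real.sin (μ * √(a * u ^ 2 + b)))
      (Real.cos (μ * √(a * u ^ 2 + b)) * (μ * (a * u / √(a * u ^ 2 + b)))) u :=
  ((hasDerivAt_sqrt_quadratic h).const_mul μ).sin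

open Filter Topology in
theorem deriv_deriv_sin_sqrt_quadratic (μ : ℝ) {a b u : ℝ} (h : 0 < a * u ^ 2 + b) :
    deriv (deriv fun u : ℝ => Real.sin (μ * √(a * u ^ 2 + b))) u =
      -(μ ^ 2 * Real.sin (μ * √(a * u ^ 2 + b)) * (a * u) ^ 2 / √(a * u ^ 2 + b) ^ 2)
        + μ * Real.cos (μ * √(a * u ^ 2 + b)) * (a * b / √(a * u ^ 2 + b) ^ 3) := by
  have hev : deriv (fun u : ℝ => Real.sin (μ * √(a * u ^ 2 + b))) =ᶠ[𝓝 u]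
      fun u => Real.cos (μ * √(a * u ^ 2 + b)) * (μ * (a * u / √(a * u ^ 2 + b))) := by
    have hc : Continuous fun u : ℝ => a * u ^ 2 + b := by fun_prop
    filter_upwards [hc.continuousAt.eventually (lt_mem_nhds h)] with v hv
    exact (hasDerivAt_sin_sqrt_quadratic μ hv).deriv
  have hr := hasDerivAt_sqrt_quadratic h
  have hpos : √(a * u ^ 2 + b) ≠ 0 := (Real.sqrt_pos.2 h).ne'
  have hd := (hr.const_mul μ).cos.mul
    ((((hasDerivAt_id u).const_mul a).div hr hpos).const_mul μ)
  have hsq : √(a * u ^ 2 + b) ^ 2 = a * u ^ 2 + b := Real.sq_sqrt h.le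
  rw [hev.deriv_eq]
  refine hd.deriv.trans ?_
  simp only [id, Pi.div_apply]
  generalize √(a * u ^ 2 + b) = r at hpos hsq ⊢
  field_simp
  linear_combination (a * μ * Real.cos (μ * r)) * hsq

/-- The generalized fractional Erdélyi–Kober kernel
`K(x,t) = sin(μ √(x² - t²))` satisfies, for `0 < t < x`, the hyperbolic equation
`∂ₜₜK = ∂ₓₓK - (1/x) ∂ₓK + μ² K`. -/
theorem sin_kernel_hyperbolic
    (μ : ℝ) (K : ℝ → ℝ → ℝ)
    (hK : ∀ x t : ℝ, K x t = Real.sin (μ * Real.sqrt (x ^ 2 - t ^ 2))) :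
    ∀ x t : ℝ, 0 < t → t < x →
      deriv (deriv (fun s => K x s)) t
        = deriv (deriv (fun y => K y t)) x - 1 / x * deriv (fun y => K y t) x
          + μ ^ 2 * K x t := by
  intro x t ht htx
  have hx : x ≠ 0 := (ht.trans htx).ne'
  have hq : 0 < x ^ 2 - t ^ 2 := by nlinarith
  have h_time : 0 < (-1) * t ^ 2 + x ^ 2 := by linarith
  have h_space : 0 < 1 * x ^ 2 + -t ^ 2 := by linarith
  have e_time : (fun s => K x s) = fun s => Real.sin (μ * √((-1) * s ^ 2 + x ^ 2)) := by
    funext s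
    rw [hK]
    ring_nf
  have e_space : (fun y => K y t) = fun y => Real.sin (μ * √(1 * y ^ 2 + -t ^ 2)) := by
    funext y
    rw [hK]
    ring_nf
  rw [e_time, e_space, hK, deriv_deriv_sin_sqrt_quadratic μ h_time,
    deriv_deriv_sin_sqrt_quadratic μ h_space, (hasDerivAt_sin_sqrt_quadratic μ h_space).deriv,
    show (-1) * t ^ 2 + x ^ 2 = x ^ 2 - t ^ 2 by ring,
    show 1 * x ^ 2 + -t ^ 2 = x ^ 2 - t ^ 2 by ring]
  have hpos : √(x ^ 2 - t ^ 2) ≠ 0 := (Real.sqrt_pos.2 hq).ne'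
  have hsq : √(x ^ 2 - t ^ 2) ^ 2 = x ^ 2 - t ^ 2 := Real.sq_sqrt hq.le
  generalize √(x ^ 2 - t ^ 2) = r at hpos hsq ⊢
  have ht2 : t ^ 2 = x ^ 2 - r ^ 2 := by linarith
  simp only [mul_pow, ht2]
  field_simp
  ring
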